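/- Let K be a compact connected metrizable abelian group of finite dimension (equivalently, whose Pontryagin dual is a countable torsion-free abelian group of finite rank), and let Γ be a group of pairwise commuting continuous automorphisms of K. If Γ is ergodic on K, then there exists α ∈ Γ which is ergodic on K. -/

import Mathlib

open MeasureTheory Topology Set

set_option linter.unusedVariables false

namespace ErgZd

variable {K : Type*}

/-- The group of bi-continuous automorphisms of a topological group,
as a subgroup of `MulAut K`. -/
def ContAut (K : Type*) [Group K] [TopologicalSpace K] : Subgroup (MulAut K) where
  carrier := {α | Continuous α ∧ Continuous α.symm}
  one_mem' := ⟨continuous_id, continuous_id⟩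
  mul_mem' := fun {a b} ha hb => ⟨ha.1.comp hb.1, hb.2.comp ha.2⟩
  inv_mem' := fun {a} ha => ⟨ha.2, ha.1⟩

section Defs

variable [Group K] [TopologicalSpace K]

lemma ContAut.continuous (α : ↥(ContAut K)) : Continuous ⇑(α : MulAut K) := α.2.1

lemma ContAut.continuous_symm (α : ↥(ContAut K)) :
    Continuous ⇑(α : MulAut K).symm := α.2.2

/-- Ergodicity of the action of a set `S` of automorphisms with respect to `μ`:
every invariant Borel set is null or conull. -/
def ErgSet [MeasurableSpace K] (μ : Measure K) (S : Set ↥(ContAut K)) : Prop :=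
  ∀ A : Set K, MeasurableSet A → (∀ α ∈ S, (α : MulAut K) '' A = A) → μ A = 0 ∨ μ A = 1

/-- Ergodicity of a single automorphism: ergodicity of the group of its integer powers. -/
def ErgAut [MeasurableSpace K] (μ : Measure K) (α : ↥(ContAut K)) : Prop :=
  ErgSet μ (Set.range fun n : ℤ => α ^ n)

/-- Distality of the action of a set of automorphisms: for `x ≠ 1`, the identity is
not in the closure of the orbit of `x`. -/
def DistalSet (S : Set ↥(ContAut K)) : Prop :=
  ∀ x : K, x ≠ 1 → (1 : K) ∉ closure ((fun α : ↥(ContAut K) => (α : MulAut K) x) '' S)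

/-- Distality of a single automorphism. -/
def DistalAut (α : ↥(ContAut K)) : Prop := DistalSet (Set.range fun n : ℤ => α ^ n)

/-- The descending chain condition for an action: every decreasing
sequence of closed invariant subgroups is eventually constant. -/
def HasDCC (S : Set ↥(ContAut K)) : Prop :=
  ∀ C : ℕ → Subgroup K, (∀ n, IsClosed (C n : Set K)) → (∀ n, C (n + 1) ≤ C n) →
    (∀ n, ∀ α ∈ S, ∀ x, x ∈ C n ↔ (α : MulAut K) x ∈ C n) → ∃ N, ∀ n, N ≤ n → C n = C N

/-- Restriction of an automorphism to an invariant subgroup. -/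
def restrictAut (H : Subgroup K) (α : ↥(ContAut K))
    (h : ∀ x, x ∈ H ↔ (α : MulAut K) x ∈ H) : ↥(ContAut ↥H) := by
  refine ⟨⟨⟨fun x => ⟨(α : MulAut K) x, (h x).mp x.2⟩,
      fun x => ⟨(α : MulAut K).symm x, (h _).mpr (by simpa using x.2)⟩, ?_, ?_⟩, ?_⟩, ?_, ?_⟩
  · intro x; ext; simp
  · intro x; ext; simp
  · intro x y; ext; simp
  · exact Continuous.subtype_mk ((ContAut.continuous α).comp continuous_subtype_val) _
  · exact Continuous.subtype_mk ((ContAut.continuous_symm α).comp continuous_subtype_val) _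

@[simp] lemma restrictAut_coe (H : Subgroup K) (α : ↥(ContAut K))
    (h : ∀ x, x ∈ H ↔ (α : MulAut K) x ∈ H) (x : ↥H) :
    ((((restrictAut H α h) : MulAut ↥H) x : ↥H) : K) = (α : MulAut K) (x : K) := rfl

/-- The automorphism induced on the quotient by an invariant closed normal subgroup. -/
def quotAut (N : Subgroup K) [N.Normal] (α : ↥(ContAut K))
    (h : ∀ x, x ∈ N ↔ (α : MulAut K) x ∈ N) : ↥(ContAut (K ⧸ N)) := by
  have hmap : N.map ((α : MulAut K) : K ≃* K) = N := by
    ext y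
    constructor
    · rintro ⟨x, hx, rfl⟩; exact (h x).mp hx
    · intro hy
      exact ⟨(α : MulAut K).symm y, (h _).mpr (by simpa using hy), by simp⟩
  refine ⟨QuotientGroup.congr N N ((α : MulAut K) : K ≃* K) hmap, ?_, ?_⟩
  · apply (QuotientGroup.isQuotientMap_mk N).continuous_iff.mpr
    have : ⇑(QuotientGroup.congr N N ((α : MulAut K) : K ≃* K) hmap) ∘ (QuotientGroup.mk : K → K ⧸ N)
        = (QuotientGroup.mk : K → K ⧸ N) ∘ ⇑(α : MulAut K) := by
      funext x
      exact QuotientGroup.congr_mk N N _ hmap x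
    rw [this]
    exact QuotientGroup.continuous_mk.comp (ContAut.continuous α)
  · apply (QuotientGroup.isQuotientMap_mk N).continuous_iff.mpr
    have : ⇑(QuotientGroup.congr N N ((α : MulAut K) : K ≃* K) hmap).symm ∘ (QuotientGroup.mk : K → K ⧸ N)
        = (QuotientGroup.mk : K → K ⧸ N) ∘ ⇑((α : MulAut K) : K ≃* K).symm := by
      funext x
      rfl
    rw [this]
    exact QuotientGroup.continuous_mk.comp (ContAut.continuous_symm α)

end Defs

theorem finite_setOf_isOfFinOrder (L : Type*) [Field L] [NumberField L] :
    {x : L | IsOfFinOrder x}.Finite := by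
  refine (NumberField.Embeddings.finite_of_norm_le L ℂ 1).subset fun x hx => ?_
  obtain ⟨n, hn, h1⟩ := isOfFinOrder_iff_pow_eq_one.1 hx
  refine ⟨IsIntegral.of_pow hn (h1 ▸ isIntegral_one), fun φ => ?_⟩
  have : ‖φ x‖ ^ n = 1 := by rw [← norm_pow, ← map_pow, h1, map_one, norm_one]
  exact ((pow_eq_one_iff_of_nonneg (norm_nonneg _) hn.ne').1 this).le

/-- Elements whose image in a commutative monoid has finite order form a subgroup. -/
def finOrderSubgroup {G M : Type*} [Group G] [CommMonoid M] (φ : G →* M) : Subgroup G where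
  carrier := {g | IsOfFinOrder (φ g)}
  one_mem' := by simp
  mul_mem' := fun {a b} ha hb => by
    simpa using IsOfFinOrder.mul ha hb
  inv_mem' := fun {a} ha => by
    obtain ⟨n, hn, h1⟩ := isOfFinOrder_iff_pow_eq_one.1 ha
    refine isOfFinOrder_iff_pow_eq_one.2 ⟨n, hn, ?_⟩
    calc φ a⁻¹ ^ n = φ a ^ n * φ a⁻¹ ^ n := by rw [h1, one_mul]
      _ = 1 := by rw [← mul_pow, ← map_mul]; simp

theorem finOrderSubgroup_eq_top {G M : Type*} [CommGroup G] [CommMonoid M] (φ : G →* M)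
    (h : (finOrderSubgroup φ).FiniteIndex) : finOrderSubgroup φ = ⊤ := by
  refine eq_top_iff.2 fun g _ => ?_
  have h1 : g ^ (finOrderSubgroup φ).index ∈ finOrderSubgroup φ := Subgroup.pow_index_mem _ g
  have h2 : IsOfFinOrder (φ g ^ (finOrderSubgroup φ).index) := by
    rw [← map_pow]; exact h1
  exact (IsOfFinOrder.of_pow h2 h.index_ne_zero : IsOfFinOrder (φ g))

open scoped IsMulCommutative in
theorem exists_forall_pow_fixed_eq_zero_rat {G V : Type*} [CommGroup G] [AddCommGroup V]
    [Module ℚ V] [FiniteDimensional ℚ V] (ρ : G →* Module.End ℚ V)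
    (h : ∀ v : V, v ≠ 0 → (range fun g => ρ g v).Infinite) :
    ∃ g, ∀ n : ℕ, 0 < n → ∀ v, ρ (g ^ n) v = v → v = 0 := by
  classical
  let A := Algebra.adjoin ℚ (range ρ)
  have : IsMulCommutative A := Algebra.isMulCommutative_adjoin ℚ (by
    rintro _ ⟨a, rfl⟩ _ ⟨b, rfl⟩
    rw [← map_mul, ← map_mul, mul_comm])
  have : Module.Finite ℚ A := FiniteDimensional.finiteDimensional_subalgebra A
  have : IsArtinianRing A := IsArtinianRing.of_finite ℚ A
  let a : G →* A :=
    { toFun := fun g => ⟨ρ g, Algebra.subset_adjoin ⟨g, rfl⟩⟩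
      map_one' := Subtype.ext (map_one ρ)
      map_mul' := fun x y => Subtype.ext (map_mul ρ x y) }
  have ha : ∀ g (v : V), a g • v = ρ g v := fun g v => rfl
  let φ : ∀ m : MaximalSpectrum A, G →* A ⧸ m.asIdeal := fun m =>
    (Ideal.Quotient.mk m.asIdeal : A →* A ⧸ m.asIdeal).comp a
  by_contra! hcon
  have hcover : ∀ g, ∃ m, g ∈ finOrderSubgroup (φ m) := by
    intro g
    obtain ⟨n, hn, v, hv, hv0⟩ := hcon g
    have hnu : ¬ IsUnit (a g ^ n - 1) := by
      intro hu
      obtain ⟨b, hb⟩ := hu.exists_left_inv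
      apply hv0
      have : (b * (a g ^ n - 1)) • v = v := by rw [hb, one_smul]
      rw [← this, mul_smul, sub_smul, ← map_pow, ha, hv, one_smul, sub_self, smul_zero]
    obtain ⟨m, hm, hmem⟩ := exists_max_ideal_of_mem_nonunits hnu
    refine ⟨⟨m, hm⟩, isOfFinOrder_iff_pow_eq_one.2 ⟨n, hn, ?_⟩⟩
    have := (Ideal.Quotient.eq_zero_iff_mem (I := m)).2 hmem
    rw [map_sub, map_pow, map_one, sub_eq_zero] at this
    exact this
  have : Finite (MaximalSpectrum A) := inferInstance
  have := Fintype.ofFinite (MaximalSpectrum A)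
  obtain ⟨m, -, hm⟩ := Subgroup.exists_finiteIndex_of_leftCoset_cover (s := Finset.univ)
    (H := fun m => finOrderSubgroup (φ m)) (g := fun _ => 1) (by
      refine eq_univ_of_forall fun g => ?_
      obtain ⟨m, hm⟩ := hcover g
      exact mem_iUnion₂.2 ⟨m, Finset.mem_univ _, by simpa using hm⟩)
  have htop := finOrderSubgroup_eq_top _ hm
  have := m.isMaximal
  have hfd : Module.Finite ℚ (A ⧸ m.asIdeal) :=
    Module.Finite.of_surjective (Ideal.Quotient.mkₐ ℚ m.asIdeal).toLinearMap
      (Ideal.Quotient.mkₐ_surjective ℚ m.asIdeal)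
  let : Field (A ⧸ m.asIdeal) := Ideal.Quotient.field m.asIdeal
  have : NumberField (A ⧸ m.asIdeal) :=
    { to_charZero := algebraRat.charZero _
      to_finiteDimensional := by
        convert hfd
        exact Subsingleton.elim _ _ }
  have hfin : (range (φ m)).Finite := by
    refine (finite_setOf_isOfFinOrder (A ⧸ m.asIdeal)).subset ?_
    rintro _ ⟨g, rfl⟩
    have : g ∈ finOrderSubgroup (φ m) := htop ▸ Subgroup.mem_top g
    exact this
  have : IsScalarTower ℚ A V := inferInstance
  have : Module.Finite A V := Module.Finite.of_restrictScalars_finite ℚ A V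
  have hass : m.asIdeal ∈ associatedPrimes A V := by
    apply Module.associatedPrimes.minimalPrimes_annihilator_subset_associatedPrimes
    have hann : Module.annihilator A V = ⊥ := by
      refine eq_bot_iff.2 fun x hx => ?_
      rw [Module.mem_annihilator] at hx
      exact Subtype.ext (LinearMap.ext fun v => hx v)
    rw [hann]
    refine ⟨⟨inferInstance, bot_le⟩, fun q hq hle => ?_⟩
    have := hq.1
    have hqm : q.IsMaximal := inferInstance
    exact (hqm.eq_of_le m.isMaximal.ne_top hle).ge
  obtain ⟨-, v, hv⟩ := Submodule.isAssociatedPrime_iff.1 hass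
  have hmv : ∀ x : A, x ∈ m.asIdeal ↔ x • v = 0 := fun x => by
    rw [hv]; simp
  have hv0 : v ≠ 0 := by
    rintro rfl
    exact m.isMaximal.ne_top ((Ideal.eq_top_iff_one _).2 ((hmv 1).2 (smul_zero _)))
  refine h v hv0 ?_
  refine (hfin.image fun y => (Function.invFun (φ m) y : G)).image (ρ · v) |>.subset ?_
  rintro _ ⟨g, rfl⟩
  refine ⟨_, ⟨φ m g, ⟨g, rfl⟩, rfl⟩, ?_⟩
  have hg : φ m (Function.invFun (φ m) (φ m g)) = φ m g := Function.invFun_eq ⟨g, rfl⟩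
  have hsub := (hmv _).1 (Ideal.Quotient.eq.1 hg)
  rwa [sub_smul, sub_eq_zero] at hsub

/-- A commutative group acting on a torsion-free abelian group of finite rank with all nonzero
orbits infinite contains an element without nonzero periodic points. -/
theorem exists_forall_pow_fixed_eq_zero {G X : Type*} [CommGroup G] [AddCommGroup X] {r : ℕ}
    (f : X →ₗ[ℤ] (Fin r → ℚ)) (hf : Function.Injective f) (ρ : G →* Module.End ℤ X)
    (h : ∀ x : X, x ≠ 0 → (range fun g => ρ g x).Infinite) :
    ∃ g, ∀ n : ℕ, 0 < n → ∀ x, ρ (g ^ n) x = x → x = 0 := by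
  let ι : X →ₗ[ℤ] TensorProduct ℤ ℚ X := TensorProduct.mk ℤ ℚ X 1
  let F : TensorProduct ℤ ℚ X →ₗ[ℚ] (Fin r → ℚ) := f.liftBaseChange ℚ
  have hFι : ∀ x, F (ι x) = f x := fun x =>
    (LinearMap.liftBaseChange_tmul ℚ f 1 x).trans (one_smul _ _)
  have hι : Function.Injective ι := fun x y hxy => hf (by rw [← hFι, ← hFι, hxy])
  have : IsLocalizedModule (nonZeroDivisors ℤ) ι :=
    IsLocalization.tensorProduct_isLocalizedModule (nonZeroDivisors ℤ) ℚ
  have hdenom : ∀ z, ∃ q : ℚ, q ≠ 0 ∧ ∃ x, q • z = ι x := fun z => by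
    obtain ⟨⟨x, s⟩, hz⟩ := IsLocalizedModule.surj (nonZeroDivisors ℤ) ι z
    exact ⟨(s : ℤ), Int.cast_ne_zero.2 (nonZeroDivisors.coe_ne_zero s), x,
      (Int.cast_smul_eq_zsmul ℚ (s : ℤ) z).trans hz⟩
  have hF : Function.Injective F := by
    refine (injective_iff_map_eq_zero F).2 fun z hz => ?_
    obtain ⟨n, hn, x, hx⟩ := hdenom z
    have hfx : f x = 0 := by rw [← hFι, ← hx, map_smul, hz, smul_zero]
    rw [(map_eq_zero_iff f hf).1 hfx, map_zero] at hx
    exact (smul_eq_zero.1 hx).resolve_left hn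
  have : FiniteDimensional ℚ (TensorProduct ℤ ℚ X) := FiniteDimensional.of_injective F hF
  let ρ' : G →* Module.End ℚ (TensorProduct ℤ ℚ X) :=
    (Module.End.baseChangeHom ℤ ℚ X : Module.End ℤ X →* _).comp ρ
  have hρ' : ∀ g x, ρ' g (ι x) = ι (ρ g x) := fun g x => rfl
  obtain ⟨g, hg⟩ := exists_forall_pow_fixed_eq_zero_rat ρ' fun z hz hfin => by
    obtain ⟨n, hn, x, hx⟩ := hdenom z
    have hx0 : x ≠ 0 := by
      rintro rfl
      rw [map_zero] at hx
      exact hz ((smul_eq_zero.1 hx).resolve_left hn)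
    refine h x hx0 (Set.Finite.of_finite_image (f := ι) ((hfin.image (n • ·)).subset ?_)
      hι.injOn)
    rintro _ ⟨_, ⟨g, rfl⟩, rfl⟩
    refine ⟨_, ⟨g, rfl⟩, ?_⟩
    simp only [← hρ', ← hx, map_smul]
  refine ⟨g, fun n hn x hx => hι ?_⟩
  rw [map_zero]
  exact hg n hn _ (by rw [hρ', hx])

/-- A nonzero element of the bicommutant of a commuting, star-closed set in a C⋆-algebra is
detected by a multiplicative functional. -/
theorem exists_characterSpace_apply_ne_zero {A : Type*} [CStarAlgebra A] {s : Set A}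
    (hs : ∀ x ∈ s, star x ∈ s) (hcomm : ∀ x ∈ s, ∀ y ∈ s, x * y = y * x) :
    ∃ B : StarSubalgebra ℂ A, s ⊆ B ∧
      (∀ x, (∀ y, (∀ z ∈ s, z * y = y * z) → y * x = x * y) → x ∈ B) ∧
      ∀ T : B, T ≠ 0 → ∃ ψ : B →⋆ₐ[ℂ] ℂ, Continuous ψ ∧ ψ T ≠ 0 := by
  have hstar : s ∪ star s = s := by
    refine union_eq_left.2 fun x hx => ?_
    simpa using hs _ hx
  let B : StarSubalgebra ℂ A :=
    StarSubalgebra.centralizer ℂ (StarSubalgebra.centralizer ℂ s : Set A)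
  have hB : (B : Set A) = s.centralizer.centralizer := by
    rw [StarSubalgebra.coe_centralizer_centralizer, hstar]
  have hBc : IsClosed (B : Set A) := hB ▸ Set.isClosed_centralizer _
  refine ⟨B, ?_, ?_, ?_⟩
  · rw [hB]; exact Set.subset_centralizer_centralizer
  · intro x hx
    rw [← SetLike.mem_coe, hB]
    exact fun y hy => hx y hy
  intro T hT
  have hmc : ∀ a b : B, a * b = b * a := by
    rintro ⟨a, ha⟩ ⟨b, hb⟩
    rw [← SetLike.mem_coe, hB] at ha hb
    exact Subtype.ext (Set.centralizer_centralizer_comm_of_comm hcomm _ ha _ hb)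
  let : CommCStarAlgebra B :=
    { (inferInstance : CStarAlgebra B) with mul_comm := hmc }
  by_contra! hcon
  apply hT
  apply (gelfandTransform_bijective B).injective
  ext φ
  simpa using hcon φ (map_continuous φ)

section L2
set_option linter.unusedSectionVars false
open scoped ComplexConjugate InnerProductSpace

theorem integrable_coeFn {K : Type*} [MeasurableSpace K] {μ : Measure K} [IsProbabilityMeasure μ]
    (f : Lp ℂ 2 μ) : Integrable f μ :=
  (Lp.memLp f).integrable (by norm_num)

theorem integral_norm_le_norm {K : Type*} [MeasurableSpace K] {μ : Measure K}
    [IsProbabilityMeasure μ] (f : Lp ℂ 2 μ) : ∫ x, ‖f x‖ ∂μ ≤ ‖f‖ := by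
  rw [integral_norm_eq_lintegral_enorm (Lp.aestronglyMeasurable f), Lp.norm_def,
    ← eLpNorm_one_eq_lintegral_enorm]
  exact ENNReal.toReal_mono (Lp.eLpNorm_ne_top f)
    (eLpNorm_le_eLpNorm_of_exponent_le (by norm_num) (Lp.aestronglyMeasurable f))

variable {K : Type*} [CommGroup K] [TopologicalSpace K] [IsTopologicalGroup K]
    [CompactSpace K] [SecondCountableTopology K] [T2Space K]
    [MeasurableSpace K] [BorelSpace K]
    (μ : Measure K) [μ.IsHaarMeasure] [IsProbabilityMeasure μ]

/-- Translation by `t` as a unitary operator on `L²`. -/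
noncomputable def translateL2 (t : K) : Lp ℂ 2 μ ≃ₗᵢ[ℂ] Lp ℂ 2 μ where
  toFun g := DomMulAct.mk t • g
  invFun g := DomMulAct.mk t⁻¹ • g
  left_inv g := by simp [← mul_smul]
  right_inv g := by simp [← mul_smul]
  map_add' := smul_add _
  map_smul' c g := smul_comm _ _ _
  norm_map' g := DomMulAct.norm_smul_Lp _ g

variable {μ}

theorem translateL2_mul (s t : K) (g : Lp ℂ 2 μ) :
    translateL2 μ (s * t) g = translateL2 μ s (translateL2 μ t g) := by
  simp only [translateL2, LinearIsometryEquiv.coe_mk, LinearEquiv.coe_mk, LinearMap.coe_mk,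
    AddHom.coe_mk, ← mul_smul, ← DomMulAct.mk_mul, mul_comm]

theorem translateL2_ae_eq (t : K) (g : Lp ℂ 2 μ) : translateL2 μ t g =ᵐ[μ] fun x => g (t * x) :=
  DomMulAct.smul_Lp_ae_eq _ g

theorem continuous_translateL2 (g : Lp ℂ 2 μ) : Continuous fun t => translateL2 μ t g := by
  have : Fact ((2 : ENNReal) ≠ ⊤) := ⟨by norm_num⟩
  have : μ.Regular := inferInstance
  exact (continuous_id.smul continuous_const).comp DomMulAct.continuous_mk

theorem integrable_smul_translateL2 {f : K → ℂ} (hf : Integrable f μ) (g : Lp ℂ 2 μ) :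
    Integrable (fun t => f t • translateL2 μ t g) μ := by
  refine Integrable.mono' (hf.norm.mul_const ‖g‖)
    (hf.1.smul (continuous_translateL2 g).aestronglyMeasurable) (.of_forall fun t => ?_)
  rw [norm_smul, LinearIsometryEquiv.norm_map]

variable (μ) in
/-- The operator `∫ f(t) Uₜ dt` on `L²`, where `Uₜ` is translation by `t`, depending
linearly on `f`. -/
noncomputable def convOp : Lp ℂ 2 μ →L[ℂ] Lp ℂ 2 μ →L[ℂ] Lp ℂ 2 μ :=
  LinearMap.mkContinuous₂
    (LinearMap.mk₂ ℂ (fun f g => ∫ t, f t • translateL2 μ t g ∂μ)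
      (fun f₁ f₂ g => by
        rw [← integral_add (integrable_smul_translateL2 (integrable_coeFn f₁) g)
          (integrable_smul_translateL2 (integrable_coeFn f₂) g)]
        refine integral_congr_ae ?_
        filter_upwards [Lp.coeFn_add f₁ f₂] with t ht
        rw [ht, Pi.add_apply, add_smul])
      (fun c f g => by
        rw [← integral_smul]
        refine integral_congr_ae ?_
        filter_upwards [Lp.coeFn_smul c f] with t ht
        rw [ht, Pi.smul_apply, smul_assoc])
      (fun f g₁ g₂ => by
        rw [← integral_add (integrable_smul_translateL2 (integrable_coeFn f) g₁)
          (integrable_smul_translateL2 (integrable_coeFn f) g₂)]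
        simp only [map_add, smul_add])
      (fun c f g => by
        rw [← integral_smul]
        simp only [map_smul, smul_comm c])) 1 (fun f g => by
    rw [one_mul]
    calc ‖∫ t, f t • translateL2 μ t g ∂μ‖ ≤ ∫ t, ‖f t • translateL2 μ t g‖ ∂μ :=
          norm_integral_le_integral_norm _
      _ = (∫ t, ‖f t‖ ∂μ) * ‖g‖ := by
          simp only [norm_smul, LinearIsometryEquiv.norm_map, integral_mul_const]
      _ ≤ ‖f‖ * ‖g‖ := by gcongr; exact integral_norm_le_norm f)

theorem convOp_apply (f g : Lp ℂ 2 μ) : convOp μ f g = ∫ t, f t • translateL2 μ t g ∂μ := rfl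

theorem convOp_translateL2 (s : K) (f g : Lp ℂ 2 μ) :
    convOp μ (translateL2 μ s f) g = translateL2 μ s⁻¹ (convOp μ f g) := by
  rw [convOp_apply, convOp_apply]
  calc ∫ t, (translateL2 μ s f) t • translateL2 μ t g ∂μ
      = ∫ t, f (s * t) • translateL2 μ (s⁻¹ * (s * t)) g ∂μ := by
        refine integral_congr_ae ?_
        filter_upwards [translateL2_ae_eq s f] with t ht
        rw [ht, inv_mul_cancel_left]
    _ = ∫ t, f t • translateL2 μ (s⁻¹ * t) g ∂μ :=
        integral_mul_left_eq_self (fun t => f t • translateL2 μ (s⁻¹ * t) g) s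
    _ = ∫ t, (translateL2 μ s⁻¹).toContinuousLinearEquiv.toContinuousLinearMap
          (f t • translateL2 μ t g) ∂μ := by
        refine integral_congr_ae (.of_forall fun t => ?_)
        simp [translateL2_mul]
    _ = _ := ContinuousLinearMap.integral_comp_comm _
        (integrable_smul_translateL2 (integrable_coeFn f) g)

theorem inner_integral_smul_translateL2 {f : K → ℂ} (hf : AEStronglyMeasurable f μ) {C : ℝ}
    (hC : ∀ᵐ t ∂μ, ‖f t‖ ≤ C) (g h : Lp ℂ 2 μ) :
    ⟪h, ∫ t, f t • translateL2 μ t g ∂μ⟫_ℂ =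
      ∫ x, (∫ t, f t * g (t * x) ∂μ) * conj (h x) ∂μ := by
  have hfi : Integrable f μ := Integrable.of_bound hf C hC
  have hfgh : Integrable (fun z : K × K => f z.2 * (conj (h z.1) * g (z.2 * z.1)))
      (μ.prod μ) := by
    have h1 : Integrable (fun z : K × K => conj (h z.1) * g z.2) (μ.prod μ) :=
      (Complex.conjCLE.integrable_comp_iff.2 (integrable_coeFn h)).mul_prod (integrable_coeFn g)
    have h2 := (measurePreserving_prod_mul μ μ).integrable_comp_of_integrable h1
    refine (h2.bdd_mul (c := C) (hf.comp_quasiMeasurePreserving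
      Measure.quasiMeasurePreserving_snd) ?_).congr (.of_forall fun z => ?_)
    · exact Measure.quasiMeasurePreserving_snd.ae hC
    · simp [mul_comm]
  rw [← integral_inner (integrable_smul_translateL2 hfi g)]
  calc ∫ t, ⟪h, f t • translateL2 μ t g⟫_ℂ ∂μ
      = ∫ t, ∫ x, f t * (conj (h x) * g (t * x)) ∂μ ∂μ := by
        refine integral_congr_ae (.of_forall fun t => ?_)
        simp only [inner_smul_right, L2.inner_def, integral_const_mul]
        congr 1
        refine integral_congr_ae ?_
        filter_upwards [translateL2_ae_eq t g] with x hx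
        rw [hx, RCLike.inner_apply, mul_comm]
    _ = ∫ x, ∫ t, f t * (conj (h x) * g (t * x)) ∂μ ∂μ :=
        (integral_integral_swap hfgh).symm
    _ = _ := by
        refine integral_congr_ae (.of_forall fun x => ?_)
        simp only [← integral_mul_const]
        refine integral_congr_ae (.of_forall fun t => ?_)
        simp only; ring

theorem eq_zero_of_convOp_eq_zero (f : Lp ℂ 2 μ) {C : ℝ} (hC : ∀ᵐ x ∂μ, ‖f x‖ ≤ C)
    (h : convOp μ f = 0) : f = 0 := by
  have key : ∀ g : C(K, ℂ), ∫ t, f t * g t ∂μ = 0 := by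
    intro g
    let F : C(K, ℂ) := ⟨fun x => ∫ t, f t * g (t * x) ∂μ, by
      refine continuous_of_dominated (bound := fun t => ‖f t‖ * ‖g‖) (fun x => ?_) (fun x => ?_)
        ((integrable_coeFn f).norm.mul_const _) ?_
      · exact (Lp.aestronglyMeasurable f).mul (by fun_prop)
      · refine .of_forall fun t => ?_
        rw [norm_mul]
        gcongr
        exact g.norm_coe_le_norm _
      · exact .of_forall fun t => by fun_prop⟩
    let g' := ContinuousMap.toLp 2 μ ℂ g
    let F' := ContinuousMap.toLp 2 μ ℂ F
    have hF : ∀ x, ∫ t, f t * g' (t * x) ∂μ = F x := fun x => by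
      refine integral_congr_ae ?_
      filter_upwards [(measurePreserving_mul_right μ x).quasiMeasurePreserving.ae
        (ContinuousMap.coeFn_toLp (p := 2) μ (𝕜 := ℂ) g)] with t ht
      rw [ht]
    have h1 := inner_integral_smul_translateL2 (Lp.aestronglyMeasurable f) hC g' F'
    rw [← convOp_apply, h] at h1
    have h2 : ⟪F', F'⟫_ℂ = 0 := by
      rw [L2.inner_def]
      rw [zero_apply, inner_zero_right] at h1
      rw [h1]
      refine integral_congr_ae ?_
      filter_upwards [ContinuousMap.coeFn_toLp (p := 2) μ (𝕜 := ℂ) F] with x hx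
      rw [hF, RCLike.inner_apply, ← hx]
    have h3 : F = 0 := ContinuousMap.toLp_injective μ (p := 2) (𝕜 := ℂ)
      ((inner_self_eq_zero.1 h2).trans (map_zero _).symm)
    simpa [F] using DFunLike.congr_fun h3 1
  refine (ContinuousMap.toLp_denseRange ℂ (p := 2) μ ℂ (by norm_num)).eq_zero_of_inner_left ℂ ?_
  intro g
  rw [L2.inner_def]
  have := congrArg conj (key (star g))
  rw [← integral_conj, map_zero] at this
  rw [← this]
  refine integral_congr_ae ?_
  filter_upwards [ContinuousMap.coeFn_toLp (p := 2) μ (𝕜 := ℂ) g] with x hx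
  rw [hx]
  simp [mul_comm]

/-- Completeness of characters: a bounded function orthogonal to all of them vanishes. -/
theorem eq_zero_of_forall_integral_mul_eq_zero (f : Lp ℂ 2 μ) {C : ℝ}
    (hC : ∀ᵐ x ∂μ, ‖f x‖ ≤ C)
    (h : ∀ χ : PontryaginDual K, ∫ x, (χ x : ℂ) * f x ∂μ = 0) : f = 0 := by
  by_contra hf0
  let U : K → (Lp ℂ 2 μ →L[ℂ] Lp ℂ 2 μ) := fun t =>
    (translateL2 μ t).toContinuousLinearEquiv.toContinuousLinearMap
  have hU : ∀ s t, U (s * t) = U s * U t := fun s t =>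
    ContinuousLinearMap.ext fun g => translateL2_mul s t g
  have hU1 : U 1 = 1 := ContinuousLinearMap.ext fun g => by simp [U, translateL2]
  have hUstar : ∀ t, star (U t) = U t⁻¹ := fun t =>
    (translateL2 μ t).adjoint_eq_symm
  obtain ⟨B, hsB, hB, hψ⟩ := exists_characterSpace_apply_ne_zero (s := range U)
    (by rintro _ ⟨t, rfl⟩; exact ⟨t⁻¹, (hUstar t).symm⟩)
    (by rintro _ ⟨s, rfl⟩ _ ⟨t, rfl⟩; rw [← hU, ← hU, mul_comm])
  have hUB : ∀ t, U t ∈ B := fun t => hsB ⟨t, rfl⟩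
  have hconvB : ∀ f, convOp μ f ∈ B := by
    refine fun f => hB _ fun S hS => ContinuousLinearMap.ext fun g => ?_
    simp only [mul_apply_eq_comp, convOp_apply]
    rw [← S.integral_comp_comm (integrable_smul_translateL2 (integrable_coeFn f) g)]
    refine integral_congr_ae (.of_forall fun t => ?_)
    have := DFunLike.congr_fun (hS (U t) ⟨t, rfl⟩) g
    simp only [map_smul]
    exact congrArg _ this.symm
  obtain ⟨ψ, hψc, hψf⟩ := hψ ⟨convOp μ f, hconvB f⟩ fun h0 =>
    hf0 (eq_zero_of_convOp_eq_zero f hC (congrArg Subtype.val h0))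
  let l : Lp ℂ 2 μ →L[ℂ] ℂ :=
    { toFun := fun f => ψ ⟨convOp μ f, hconvB f⟩
      map_add' := fun f g =>
        (congrArg ψ (Subtype.ext (map_add (convOp μ) f g) :
          (⟨convOp μ (f + g), hconvB (f + g)⟩ : B) =
            ⟨convOp μ f, hconvB f⟩ + ⟨convOp μ g, hconvB g⟩)).trans (ψ.map_add' _ _)
      map_smul' := fun c f =>
        (congrArg ψ (Subtype.ext (map_smul (convOp μ) c f) :
          (⟨convOp μ (c • f), hconvB (c • f)⟩ : B) = c • ⟨convOp μ f, hconvB f⟩)).trans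
          (ψ.toAlgHom.toLinearMap.map_smul c _)
      cont := hψc.comp ((convOp μ).continuous.subtype_mk _) }
  have hlf : l f ≠ 0 := hψf
  let χ₀ : K →* ℂ :=
    { toFun := fun t => ψ ⟨U t, hUB t⟩
      map_one' := by
        rw [← map_one ψ]; congr 1; exact Subtype.ext hU1
      map_mul' := fun s t => by
        rw [← map_mul ψ]; congr 1; exact Subtype.ext (hU s t) }
  have hl : ∀ s, l (translateL2 μ s f) = χ₀ s⁻¹ * l f := fun s => by
    change ψ _ = ψ _ * ψ _
    rw [← map_mul]
    congr 1
    exact Subtype.ext (ContinuousLinearMap.ext fun g => convOp_translateL2 s f g)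
  have hχinv : ∀ t, χ₀ t * χ₀ t⁻¹ = 1 := fun t => by rw [← map_mul, mul_inv_cancel, map_one]
  have hχstar : ∀ t, χ₀ t⁻¹ = conj (χ₀ t) := fun t => by
    change ψ _ = star (ψ _)
    rw [← map_star]
    congr 1
    exact Subtype.ext (hUstar t).symm
  have hχnorm : ∀ t, ‖χ₀ t‖ = 1 := fun t => by
    have := hχinv t
    rw [hχstar, Complex.mul_conj, Complex.normSq_eq_norm_sq] at this
    exact (pow_eq_one_iff_of_nonneg (norm_nonneg _) two_ne_zero).1 (by exact_mod_cast this)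
  have hχcont : Continuous χ₀ := by
    have : χ₀ = fun t => l (translateL2 μ t⁻¹ f) / l f := by
      funext t
      rw [hl, inv_inv, mul_div_cancel_right₀ _ hlf]
    rw [this]
    exact (l.continuous.comp ((continuous_translateL2 f).comp continuous_inv)).div_const _
  let χ : K →ₜ* Circle :=
    { toFun := fun t => ⟨χ₀ t, mem_sphere_zero_iff_norm.2 (hχnorm t)⟩
      map_one' := Subtype.ext (map_one χ₀)
      map_mul' := fun s t => Subtype.ext (map_mul χ₀ s t)
      continuous_toFun := hχcont.subtype_mk _ }
  have hχf : ∫ t, χ₀ t * f t ∂μ = 0 := h χ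
  have hχ_int : Integrable χ₀ μ := hχcont.integrable_of_hasCompactSupport
    (HasCompactSupport.of_compactSpace _)
  have hzero : ∫ t, χ₀ t • translateL2 μ t f ∂μ = 0 := by
    refine ext_inner_left ℂ fun g => ?_
    rw [inner_integral_smul_translateL2 hχcont.aestronglyMeasurable
      (.of_forall fun t => (hχnorm t).le), inner_zero_right]
    refine integral_eq_zero_of_ae (.of_forall fun x => ?_)
    have : ∫ t, χ₀ t * f (t * x) ∂μ = 0 := by
      calc ∫ t, χ₀ t * f (t * x) ∂μ = ∫ t, χ₀ x⁻¹ * (χ₀ (t * x) * f (t * x)) ∂μ := by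
            refine integral_congr_ae (.of_forall fun t => ?_)
            simp only [map_mul]
            linear_combination (-χ₀ t * f (t * x)) * hχinv x
        _ = χ₀ x⁻¹ * ∫ t, χ₀ t * f t ∂μ := by
            rw [integral_const_mul, integral_mul_right_eq_self (fun t => χ₀ t * f t)]
        _ = 0 := by rw [hχf, mul_zero]
    simp [this]
  have hlzero := congrArg l hzero
  rw [← l.integral_comp_comm (integrable_smul_translateL2 hχ_int f), map_zero] at hlzero
  refine hlf (Eq.trans ?_ hlzero)
  have : ∀ t, l (χ₀ t • translateL2 μ t f) = l f := fun t => by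
    rw [map_smul, hl, smul_eq_mul, ← mul_assoc, hχinv, one_mul]
  simp [this]

end L2

section Ergodic
open scoped ComplexConjugate InnerProductSpace

theorem image_contAut {K : Type*} [Group K] [TopologicalSpace K] (α : ↥(ContAut K)) (A : Set K) :
    (α : MulAut K) '' A = ((α⁻¹ : ↥(ContAut K)) : MulAut K) ⁻¹' A :=
  (α : MulAut K).toEquiv.image_eq_preimage_symm A

theorem measurePreserving_contAut {K : Type*} [CommGroup K] [TopologicalSpace K]
    [IsTopologicalGroup K] [CompactSpace K] [MeasurableSpace K] [BorelSpace K]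
    {μ : Measure K} [μ.IsHaarMeasure] [IsProbabilityMeasure μ] (α : ↥(ContAut K)) :
    MeasurePreserving (α : MulAut K) μ μ := by
  have hm : Measurable (α : MulAut K) := (ContAut.continuous α).measurable
  have : (μ.map (α : MulAut K)).IsHaarMeasure :=
    MulEquiv.isHaarMeasure_map μ (α : MulAut K) (ContAut.continuous α) (ContAut.continuous_symm α)
  have := Measure.isProbabilityMeasure_map (μ := μ) hm.aemeasurable
  exact ⟨hm, Measure.isHaarMeasure_eq_of_isProbabilityMeasure _ _⟩

theorem setIntegral_comp_contAut {K : Type*} [CommGroup K] [TopologicalSpace K]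
    [IsTopologicalGroup K] [CompactSpace K] [MeasurableSpace K] [BorelSpace K]
    {μ : Measure K} [μ.IsHaarMeasure] [IsProbabilityMeasure μ] (α : ↥(ContAut K))
    {A : Set K} (hA : (α : MulAut K) ⁻¹' A = A) (g : K → ℂ) :
    ∫ x in A, g ((α : MulAut K) x) ∂μ = ∫ x in A, g x ∂μ := by
  let e : K ≃ₜ K := ⟨(α : MulAut K).toEquiv, ContAut.continuous α, ContAut.continuous_symm α⟩
  have := (measurePreserving_contAut (μ := μ) α).setIntegral_preimage_emb
    e.measurableEmbedding g A
  rwa [hA] at this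

/-- The action of continuous automorphisms on characters, `χ ↦ χ ∘ α⁻¹`. -/
noncomputable def dualAction {K : Type*} [CommGroup K] [TopologicalSpace K] :
    ↥(ContAut K) →* Monoid.End (PontryaginDual K) where
  toFun α := (PontryaginDual.map
    (⟨((α⁻¹ : ↥(ContAut K)) : MulAut K), ContAut.continuous α⁻¹⟩ : K →ₜ* K)).toMonoidHom
  map_one' := rfl
  map_mul' _ _ := rfl

theorem dualAction_apply {K : Type*} [CommGroup K] [TopologicalSpace K] (α : ↥(ContAut K))
    (χ : PontryaginDual K) (x : K) :
    dualAction α χ x = χ (((α⁻¹ : ↥(ContAut K)) : MulAut K) x) := rfl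

theorem dualAction_inv_apply_dualAction {K : Type*} [CommGroup K] [TopologicalSpace K]
    (α : ↥(ContAut K)) (χ : PontryaginDual K) : dualAction α⁻¹ (dualAction α χ) = χ := by
  have : (dualAction α⁻¹ * dualAction α) χ = χ := by
    rw [← map_mul, inv_mul_cancel, map_one]; rfl
  exact this

theorem continuous_character {K : Type*} [CommGroup K] [TopologicalSpace K]
    (χ : PontryaginDual K) : Continuous fun x => (χ x : ℂ) :=
  continuous_subtype_val.comp (map_continuous χ)

theorem integrable_character {K : Type*} [CommGroup K] [TopologicalSpace K] [CompactSpace K]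
    [MeasurableSpace K] [BorelSpace K] {μ : Measure K} [μ.IsHaarMeasure] (χ : PontryaginDual K) :
    Integrable (fun x => (χ x : ℂ)) μ :=
  (continuous_character χ).integrable_of_hasCompactSupport (HasCompactSupport.of_compactSpace _)

theorem integral_character_eq_zero {K : Type*} [CommGroup K] [TopologicalSpace K]
    [IsTopologicalGroup K] [MeasurableSpace K] [BorelSpace K] {μ : Measure K} [μ.IsHaarMeasure]
    {χ : PontryaginDual K} (hχ : χ ≠ 1) : ∫ x, (χ x : ℂ) ∂μ = 0 := by
  obtain ⟨a, ha⟩ := DFunLike.ne_iff.1 hχ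
  have h1 : (χ a : ℂ) * ∫ x, (χ x : ℂ) ∂μ = ∫ x, (χ x : ℂ) ∂μ := by
    rw [← integral_const_mul, ← integral_mul_left_eq_self (fun x => (χ x : ℂ)) a]
    simp only [map_mul, Circle.coe_mul]
  by_contra h0
  exact ha (Circle.ext (mul_right_cancel₀ h0 (h1.trans (one_mul _).symm)))

variable {K : Type*} [CommGroup K] [TopologicalSpace K] [IsTopologicalGroup K]
    [CompactSpace K] [MeasurableSpace K] [BorelSpace K]
    {μ : Measure K} [μ.IsHaarMeasure] [IsProbabilityMeasure μ]

/-- Under an ergodic group, nontrivial characters have infinite orbits. -/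
theorem infinite_range_dualAction {Γ : Subgroup ↥(ContAut K)}
    (herg : ErgSet μ (Γ : Set ↥(ContAut K))) {χ : PontryaginDual K} (hχ : χ ≠ 1) :
    (range fun γ : Γ => dualAction (γ : ↥(ContAut K)) χ).Infinite := by
  intro hfin
  let O := hfin.toFinset
  have hmem : ∀ γ ∈ Γ, ∀ η ∈ O, dualAction γ η ∈ O := by
    intro γ hγ η hη
    obtain ⟨δ, rfl⟩ := hfin.mem_toFinset.1 hη
    exact hfin.mem_toFinset.2 ⟨⟨γ, hγ⟩ * δ, by simp [map_mul]⟩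
  have hχO : χ ∈ O := hfin.mem_toFinset.2 ⟨1, by simp⟩
  let F : K → ℂ := fun x => ∑ η ∈ O, (η x : ℂ)
  have hFinv : ∀ γ ∈ Γ, ∀ x, F ((γ : MulAut K) x) = F x := by
    intro γ hγ x
    refine Finset.sum_nbij' (dualAction γ⁻¹) (dualAction γ)
      (hmem _ (Γ.inv_mem hγ)) (hmem _ hγ)
      (fun η _ => by simpa using dualAction_inv_apply_dualAction γ⁻¹ η)
      (fun η _ => dualAction_inv_apply_dualAction γ η) (fun η _ => ?_)
    rw [dualAction_apply, inv_inv]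
  have hFcont : Continuous F := continuous_finsetSum _ fun η _ => continuous_character η
  have hFint : Integrable F μ := integrable_finsetSum _ fun η _ => integrable_character η
  have hF0 : ∫ x, F x ∂μ = 0 := by
    rw [integral_finsetSum _ fun η _ => integrable_character η]
    refine Finset.sum_eq_zero fun η hη => integral_character_eq_zero ?_
    obtain ⟨δ, rfl⟩ := hfin.mem_toFinset.1 hη
    exact fun h1 => hχ (((dualAction_inv_apply_dualAction (δ : ↥(ContAut K)) χ).symm.trans
      (congrArg _ h1)).trans (map_one _))
  have hre0 : ∫ x, (F x).re ∂μ = 0 := by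
    have := integral_re hFint
    simpa [hF0] using this
  have hopen : IsOpen {x | 0 < (F x).re} :=
    isOpen_lt continuous_const (Complex.continuous_re.comp hFcont)
  have hne : μ {x | 0 < (F x).re} ≠ 0 := by
    refine (hopen.measure_pos μ ⟨1, ?_⟩).ne'
    simpa [F] using Finset.card_pos.2 ⟨χ, hχO⟩
  have hone := (herg _ hopen.measurableSet fun γ hγ => by
    rw [image_contAut]
    ext x
    have := hFinv γ⁻¹ (Γ.inv_mem hγ) x
    exact (congrArg (fun z : ℂ => 0 < z.re) this).to_iff).resolve_left hne
  have hpos : ∀ᵐ x ∂μ, 0 < (F x).re := by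
    rw [← mem_ae_iff_prob_eq_one hopen.measurableSet] at hone
    exact hone
  have hae := (integral_eq_zero_iff_of_nonneg_ae (hpos.mono fun x hx => hx.le) hFint.re).1 hre0
  obtain ⟨x, hx, hx0⟩ := (hpos.and hae).exists
  exact hx.ne' hx0

theorem orthonormal_character :
    Orthonormal ℂ fun χ : PontryaginDual K =>
      ContinuousMap.toLp 2 μ ℂ ⟨fun x => (χ x : ℂ), continuous_character χ⟩ := by
  classical
  rw [orthonormal_iff_ite]
  intro χ η
  rw [ContinuousMap.inner_toLp]
  have h : ∀ x, (η x : ℂ) * conj (χ x : ℂ) = ((η * χ⁻¹ : PontryaginDual K) x : ℂ) := fun x => by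
    rw [← Circle.coe_inv_eq_conj, ← Circle.coe_mul]; rfl
  simp only [ContinuousMap.coe_mk, h]
  split_ifs with hχη
  · subst hχη
    rw [mul_inv_cancel]
    simp
  · exact integral_character_eq_zero fun h1 => hχη (mul_inv_eq_one.1 h1).symm

/-- If no nontrivial character is periodic under `α`, then `α` is ergodic. -/
theorem ergAut_of_forall_dualAction [SecondCountableTopology K] [T2Space K] {α : ↥(ContAut K)}
    (h : ∀ n : ℕ, 0 < n → ∀ χ, dualAction (α ^ n) χ = χ → χ = 1) : ErgAut μ α := by
  intro A hA hinv
  have hinv' : ∀ n : ℕ, (((α ^ n)⁻¹ : ↥(ContAut K)) : MulAut K) ⁻¹' A = A := fun n => by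
    have := hinv (α ^ n) ⟨n, zpow_natCast α n⟩
    rw [image_contAut] at this
    exact this
  have hcoef : ∀ χ : PontryaginDual K, χ ≠ 1 → ∫ x in A, (χ x : ℂ) ∂μ = 0 := by
    intro χ hχ
    have hinj : Function.Injective fun n : ℕ => dualAction (α ^ n) χ := by
      refine Function.Injective.of_lt_imp_ne fun m n hmn heq =>
        hχ (h (n - m) (Nat.sub_pos_of_lt hmn) χ ?_)
      have h1 : dualAction (α ^ m) (dualAction (α ^ (n - m)) χ) = dualAction (α ^ m) χ := by
        refine Eq.trans ?_ heq.symm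
        rw [← Nat.add_sub_of_le hmn.le, pow_add, map_mul, Nat.add_sub_cancel_left]
        rfl
      rw [← dualAction_inv_apply_dualAction (α ^ m) (dualAction (α ^ (n - m)) χ), h1,
        dualAction_inv_apply_dualAction]
    have hsum := ((orthonormal_character (μ := μ)).comp _ hinj).inner_products_summable
      (indicatorConstLp 2 hA (measure_ne_top μ A) (1 : ℂ))
    have hterm : ∀ n : ℕ, ∫ x in A, (dualAction (α ^ n) χ x : ℂ) ∂μ = ∫ x in A, (χ x : ℂ) ∂μ :=
      fun n => setIntegral_comp_contAut (α ^ n)⁻¹ (hinv' n) fun x => (χ x : ℂ)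
    have hconst : (fun n : ℕ => ‖∫ x in A, (χ x : ℂ) ∂μ‖ ^ 2) =
        fun n => ‖⟪ContinuousMap.toLp 2 μ ℂ ⟨fun x => (dualAction (α ^ n) χ x : ℂ),
          continuous_character _⟩, indicatorConstLp 2 hA (measure_ne_top μ A) (1 : ℂ)⟫_ℂ‖ ^ 2 := by
      funext n
      rw [norm_inner_symm, L2.inner_indicatorConstLp_one, ← hterm n]
      congr 2
      refine integral_congr_ae (ae_restrict_of_ae ?_)
      filter_upwards [ContinuousMap.coeFn_toLp (p := 2) μ (𝕜 := ℂ)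
        ⟨fun x => (dualAction (α ^ n) χ x : ℂ), continuous_character _⟩] with x hx
      rw [hx]
      rfl
    have h0 : Summable fun _ : ℕ => ‖∫ x in A, (χ x : ℂ) ∂μ‖ ^ 2 := hconst ▸ hsum
    simpa using (summable_const_iff _).1 h0
  let g : K → ℂ := fun x => A.indicator 1 x - (μ.real A : ℂ)
  have hgm : AEStronglyMeasurable g μ :=
    ((measurable_one.indicator hA).sub measurable_const).aestronglyMeasurable
  have hgb : ∀ x, ‖g x‖ ≤ 1 + ‖(μ.real A : ℂ)‖ := fun x => by
    refine (norm_sub_le _ _).trans ?_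
    gcongr
    by_cases hx : x ∈ A <;> simp [hx]
  have hg : MemLp g 2 μ := MemLp.of_bound hgm _ (.of_forall hgb)
  have hzero : hg.toLp g = 0 := by
    refine eq_zero_of_forall_integral_mul_eq_zero _
      (hg.coeFn_toLp.mono fun x hx => by rw [hx]; exact hgb x) fun χ => ?_
    have hmul : ∀ x, (χ x : ℂ) * g x =
        A.indicator (fun x => (χ x : ℂ)) x - (χ x : ℂ) * (μ.real A : ℂ) := fun x => by
      by_cases hx : x ∈ A <;> simp [g, hx, mul_sub]
    calc ∫ x, (χ x : ℂ) * hg.toLp g x ∂μ = ∫ x, (χ x : ℂ) * g x ∂μ :=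
          integral_congr_ae (hg.coeFn_toLp.mono fun x hx => by simp only [hx])
      _ = ∫ x in A, (χ x : ℂ) ∂μ - (∫ x, (χ x : ℂ) ∂μ) * (μ.real A : ℂ) := by
          simp only [hmul]
          rw [integral_sub ((integrable_character χ).indicator hA)
            ((integrable_character χ).mul_const _), integral_indicator hA, integral_mul_const]
      _ = 0 := by
          by_cases hχ : χ = 1
          · subst hχ
            simp
          · rw [hcoef χ hχ, integral_character_eq_zero hχ, zero_mul, sub_zero]
  have hae : ∀ᵐ x ∂μ, g x = 0 := by
    filter_upwards [hg.coeFn_toLp, Lp.coeFn_zero ℂ 2 μ] with x hx h0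
    rw [← hx, hzero, h0]
    rfl
  by_cases hA1 : μ.real A = 1
  · right
    rw [measureReal_def] at hA1
    exact (ENNReal.toReal_eq_one_iff _).1 hA1
  · left
    rw [measure_eq_zero_iff_ae_notMem]
    filter_upwards [hae] with x hx hxA
    simp only [g, indicator_of_mem hxA, Pi.one_apply, sub_eq_zero] at hx
    exact hA1 (by exact_mod_cast hx.symm)

end Ergodic

/-- Theorem 5.2, Berend's theorem. Let `K` be a compact connected
metrizable abelian group of finite dimension — equivalently, whose Pontryagin dual is
(countable) torsion-free of finite rank, i.e. embeds `ℤ`-linearly in some `ℚ^r` — and let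
`Γ` be a group of pairwise commuting continuous automorphisms of `K`. If `Γ` is ergodic
on `K`, then some element of `Γ` is ergodic on `K`. -/
theorem statement18 {K : Type*} [CommGroup K] [TopologicalSpace K] [IsTopologicalGroup K]
    [CompactSpace K] [TopologicalSpace.MetrizableSpace K] [ConnectedSpace K]
    [MeasurableSpace K] [BorelSpace K]
    (hfin : ∃ (r : ℕ) (f : Additive (PontryaginDual K) →ₗ[ℤ] (Fin r → ℚ)),
      Function.Injective f)
    (μ : Measure K) [μ.IsHaarMeasure] [IsProbabilityMeasure μ]
    (Γ : Subgroup ↥(ContAut K))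
    (hcomm : ∀ a ∈ Γ, ∀ b ∈ Γ, a * b = b * a)
    (herg : ErgSet μ (Γ : Set ↥(ContAut K))) :
    ∃ a ∈ Γ, ErgAut μ a := by
  let := TopologicalSpace.metrizableSpaceMetric K
  have : SecondCountableTopology K := inferInstance
  obtain ⟨r, f, hf⟩ := hfin
  let : CommGroup Γ :=
    { (inferInstance : Group Γ) with
      mul_comm := fun a b => Subtype.ext (hcomm a a.2 b b.2) }
  let ρ : Γ →* Module.End ℤ (Additive (PontryaginDual K)) :=
    { toFun := fun γ => (MonoidHom.toAdditive (dualAction (γ : ↥(ContAut K)))).toIntLinearMap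
      map_one' := rfl
      map_mul' := fun _ _ => rfl }
  obtain ⟨a, ha⟩ := exists_forall_pow_fixed_eq_zero f hf ρ fun χ hχ =>
    infinite_range_dualAction herg (χ := χ.toMul) hχ
  exact ⟨a, a.2, ergAut_of_forall_dualAction fun n hn χ hχ => ha n hn (Additive.ofMul χ) hχ⟩

end ErgZd
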